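/- Affinely rescaling a canonical folding map on a symmetric subinterval yields again a canonical folding map: fix α > 1, t ∈ (0,1] and s ∈ (0,1], and let B : ℝ → ℝ be an increasing affine map with B(q_t(s)) = -1 and B(q_t(0)) ≤ 1. Then, setting ρ = (B(q_t(0)) + 1)/2 ∈ [0,1], one has B(q_t(s·x)) = q_ρ(x) for all x ∈ [-1,1]. -/

import Mathlib

/-- The canonical folding map with critical exponent `α` and peak-value `t`:
`q_t(x) = -2t|x|^α + 2t - 1` (here `^` is the real power). -/
noncomputable def foldMap (α t x : ℝ) : ℝ := -2 * t * |x| ^ α + 2 * t - 1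

/-- Affinely rescaling a canonical folding map on a symmetric subinterval yields again a
canonical folding map: if `α > 1`, `t, s ∈ (0,1]` and `B` is an increasing affine map with
`B (q_t s) = -1` and `B (q_t 0) ≤ 1`, then with `ρ = (B (q_t 0) + 1)/2 ∈ [0,1]` one has
`B (q_t (s·x)) = q_ρ x` for all `x ∈ [-1,1]`. -/
theorem rescaled_folding_is_folding (α : ℝ) (hα : 1 < α)
    (t : ℝ) (ht : t ∈ Set.Ioc (0 : ℝ) 1) (s : ℝ) (hs : s ∈ Set.Ioc (0 : ℝ) 1)
    (B : ℝ → ℝ) (m c : ℝ) (hm : 0 < m) (hB : ∀ x, B x = m * x + c)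
    (hB1 : B (foldMap α t s) = -1) (hB2 : B (foldMap α t 0) ≤ 1) :
    (B (foldMap α t 0) + 1) / 2 ∈ Set.Icc (0 : ℝ) 1 ∧
    ∀ x ∈ Set.Icc (-1 : ℝ) 1,
      B (foldMap α t (s * x)) = foldMap α ((B (foldMap α t 0) + 1) / 2) x := by
  have h0 : foldMap α t 0 = 2 * t - 1 := by
    simp [foldMap, Real.zero_rpow (zero_lt_one.trans hα).ne']
  rw [hB, foldMap, abs_of_pos hs.1] at hB1
  rw [hB, h0] at hB2
  rw [hB (foldMap α t 0), h0]
  have hρ : (m * (2 * t - 1) + c + 1) / 2 = m * t * s ^ α := by linarith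
  refine ⟨⟨?_, by linarith⟩, fun x _ => ?_⟩
  · rw [hρ]
    exact mul_nonneg (mul_nonneg hm.le ht.1.le) (Real.rpow_nonneg hs.1.le α)
  · rw [hρ, hB, foldMap, foldMap, abs_mul, abs_of_pos hs.1,
      Real.mul_rpow hs.1.le (abs_nonneg x)]
    linear_combination hB1
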